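/- Let (V,E) be a finite DAG, let k, c, d be natural numbers with c ≤ k, d = k − c and k > 3d, and let (s_i, t_i) for i ∈ {1,…,k} be terminal pairs of vertices. Suppose P_1,…,P_k is a family of paths such that each P_i is a shortest path from s_i to t_i, every vertex has congestion at most c with respect to (P_1,…,P_k), and some vertex has congestion exactly c. Then there exists a family of paths P'_1,…,P'_k such that each P'_i is a shortest path from s_i to t_i, every vertex has the same congestion with respect to (P'_1,…,P'_k) as with respect to (P_1,…,P_k), and there exists an index a ∈ {1,…,k} such that P'_a contains every vertex whose congestion is exactly c. -/

import Mathlib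

/-- A walk from `s` to `t` in the digraph `(V, E)`: a nonempty list of vertices starting
at `s`, ending at `t`, with `E` holding between consecutive vertices. -/
def IsWalk {V : Type*} (E : V → V → Prop) (s t : V) (W : List V) : Prop :=
  W ≠ [] ∧ W.head? = some s ∧ W.getLast? = some t ∧ W.Chain' E

/-- The length of a walk: the number of consecutive pairs (edges). -/
def walkLength {V : Type*} (W : List V) : ℕ := W.length - 1

/-- A path: a walk with pairwise distinct vertices. -/
def IsPath {V : Type*} (E : V → V → Prop) (s t : V) (W : List V) : Prop :=
  IsWalk E s t W ∧ W.Nodup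

/-- Acyclicity: no walk of positive length starts and ends at the same vertex. -/
def IsAcyclic {V : Type*} (E : V → V → Prop) : Prop :=
  ∀ (v : V) (W : List V), IsWalk E v v W → walkLength W = 0

/-- The distance from `s` to `t`: the minimum length of a walk from `s` to `t`. -/
noncomputable def walkDist {V : Type*} (E : V → V → Prop) (s t : V) : ℕ :=
  sInf {n | ∃ W, IsWalk E s t W ∧ walkLength W = n}

/-- A shortest path from `s` to `t`: a path from `s` to `t` of length `walkDist E s t`. -/
def IsShortestPath {V : Type*} (E : V → V → Prop) (s t : V) (W : List V) : Prop :=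
  IsPath E s t W ∧ walkLength W = walkDist E s t

/-- The congestion of a vertex `v` with respect to a family of walks:
the number of members of the family containing `v`. -/
noncomputable def congestion {V : Type*} {ι : Type*} (P : ι → List V) (v : V) : ℕ :=
  Nat.card {i : ι // v ∈ P i}

section Rerouting

variable {V : Type*} {E : V → V → Prop}

lemma exists_isWalk_of_transGen {u v : V} (h : Relation.TransGen E u v) :
    ∃ W, IsWalk E u v W ∧ 0 < walkLength W := by
  induction h using Relation.TransGen.head_induction_on with
  | @single a h =>
    exact ⟨[a, v], ⟨by simp, by simp, by simp, List.isChain_pair.2 h⟩, by simp [walkLength]⟩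
  | @head a b h _ ih =>
    obtain ⟨W, ⟨hne, hh, hl, hc⟩, -⟩ := ih
    obtain ⟨x, W, rfl⟩ := List.exists_cons_of_ne_nil hne
    obtain rfl : x = b := by simpa using hh
    refine ⟨a :: x :: W, ⟨by simp, by simp, by simpa using hl, ?_⟩, by simp [walkLength]⟩
    exact List.isChain_cons_cons.2 ⟨h, hc⟩

/-- A finite acyclic digraph has a topological rank. -/
lemma IsAcyclic.exists_rank [Finite V] (h : IsAcyclic E) :
    ∃ r : V → ℕ, ∀ u v, E u v → r u < r v := by
  refine ⟨fun v => {u | Relation.TransGen E u v}.ncard, fun u v huv => ?_⟩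
  refine Set.ncard_lt_ncard ⟨fun w hw => hw.tail huv, fun hsub => ?_⟩ (Set.toFinite _)
  obtain ⟨W, hW, hpos⟩ := exists_isWalk_of_transGen (hsub (Relation.TransGen.single huv))
  exact hpos.ne' (h u W hW)

lemma IsWalk.pairwise_rank {r : V → ℕ} (hr : ∀ u v, E u v → r u < r v) {s t : V} {W : List V}
    (hW : IsWalk E s t W) : W.Pairwise (fun x y => r x < r y) := by
  have : IsTrans V (fun x y => r x < r y) := ⟨fun _ _ _ => lt_trans⟩
  exact List.isChain_iff_pairwise.1 (List.IsChain.imp (fun u v => hr u v) hW.2.2.2)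

lemma walkDist_le {s t : V} {W : List V} (hW : IsWalk E s t W) :
    walkDist E s t ≤ walkLength W :=
  Nat.sInf_le ⟨W, hW, rfl⟩

lemma eq_append_of_mem_of_rank_lt {r : V → ℕ} {W : List V}
    (hW : W.Pairwise (fun x y => r x < r y)) {u w : V} (hu : u ∈ W) (hw : w ∈ W)
    (huw : r u < r w) : ∃ A B C, W = A ++ u :: (B ++ w :: C) := by
  obtain ⟨A, R, rfl⟩ := List.append_of_mem hu
  have hwR : w ∈ R := by
    rcases List.mem_append.1 hw with h | h
    · have := (List.pairwise_append.1 hW).2.2 w h u (by simp)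
      omega
    · rcases List.mem_cons.1 h with rfl | h
      · omega
      · exact h
  obtain ⟨B, C, rfl⟩ := List.append_of_mem hwR
  exact ⟨A, B, C, rfl⟩

lemma IsWalk.replace_segment {s t s' t' u w : V} {A B C A' B' C' : List V}
    (h : IsWalk E s t (A ++ u :: (B ++ w :: C)))
    (h' : IsWalk E s' t' (A' ++ u :: (B' ++ w :: C'))) :
    IsWalk E s t (A ++ u :: (B' ++ w :: C)) := by
  obtain ⟨-, hh, hl, hc⟩ := h
  obtain ⟨-, -, -, hc'⟩ := h'
  refine ⟨by simp, ?_, ?_, ?_⟩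
  · cases A <;> simpa using hh
  · simpa [List.getLast?_append, List.getLast?_cons] using hl
  · change List.IsChain E _ at hc hc'
    change List.IsChain E _
    have hc₂ := List.isChain_split.1 hc
    have hmid := (List.isChain_split (l₁ := u :: B')).1 (List.isChain_split.1 hc').2
    have hend := (List.isChain_split (l₁ := u :: B)).1 hc₂.2
    exact List.isChain_split.2 ⟨hc₂.1, (List.isChain_split (l₁ := u :: B')).2 ⟨hmid.1, hend.2⟩⟩

lemma congestion_eq_sum_count [DecidableEq V] {ι : Type*} [Fintype ι] {P : ι → List V}
    (hP : ∀ i, (P i).Nodup) (v : V) : congestion P v = ∑ i, (P i).count v := by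
  classical
  simp only [congestion, Nat.card_eq_fintype_card, Fintype.card_subtype,
    (hP _).count, Finset.sum_boole, Nat.cast_id]

/-- Two shortest paths meeting in `u` and `w` can exchange their segments between these
vertices. -/
lemma exists_swap_segment {r : V → ℕ} (hr : ∀ u v, E u v → r u < r v)
    {ι : Type*} [Fintype ι] {s t : ι → V} {P : ι → List V}
    (hP : ∀ i, IsShortestPath E (s i) (t i) (P i)) {a b : ι} (hab : a ≠ b) {u w : V}
    (huw : r u < r w) (hua : u ∈ P a) (hwa : w ∈ P a) (hub : u ∈ P b) (hwb : w ∈ P b) :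
    ∃ P' : ι → List V, (∀ i, IsShortestPath E (s i) (t i) (P' i)) ∧
      (∀ v, congestion P' v = congestion P v) ∧
      (∀ v ∈ P a, r v ≤ r u ∨ r w ≤ r v → v ∈ P' a) ∧
      (∀ v ∈ P b, r u ≤ r v → r v ≤ r w → v ∈ P' a) := by
  classical
  have hsa := (hP a).1.1.pairwise_rank hr
  have hsb := (hP b).1.1.pairwise_rank hr
  obtain ⟨A, B, C, ha⟩ := eq_append_of_mem_of_rank_lt hsa hua hwa huw
  obtain ⟨A', B', C', hb⟩ := eq_append_of_mem_of_rank_lt hsb hub hwb huw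
  rw [ha] at hsa
  rw [hb] at hsb
  have hWa := (hP a).1.1
  have hWb := (hP b).1.1
  have hla := (hP a).2
  have hlb := (hP b).2
  rw [ha] at hWa hla
  rw [hb] at hWb hlb
  have hWa' := hWa.replace_segment hWb
  have hWb' := hWb.replace_segment hWa
  have hda := walkDist_le hWa'
  have hdb := walkDist_le hWb'
  have hlen : B.length = B'.length := by
    simp only [walkLength, List.length_append, List.length_cons] at *
    omega
  set Q : ι → List V := Function.update (Function.update P a (A ++ u :: (B' ++ w :: C))) b
    (A' ++ u :: (B ++ w :: C')) with hQ
  have hQa : Q a = A ++ u :: (B' ++ w :: C) := by simp [hQ, hab]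
  have hQb : Q b = A' ++ u :: (B ++ w :: C') := by simp [hQ]
  have hQo : ∀ i, i ≠ a → i ≠ b → Q i = P i := fun i hia hib => by simp [hQ, hia, hib]
  have nodup_of_isWalk : ∀ {x y : V} {W : List V}, IsWalk E x y W → W.Nodup := fun h =>
    (h.pairwise_rank hr).imp fun hlt => by rintro rfl; exact lt_irrefl _ hlt
  have hQP : ∀ i, IsShortestPath E (s i) (t i) (Q i) := by
    intro i
    by_cases hib : i = b
    · subst hib
      rw [hQb]
      refine ⟨⟨hWb', nodup_of_isWalk hWb'⟩, ?_⟩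
      rw [← hlb]
      simp [walkLength, hlen]
    · by_cases hia : i = a
      · subst hia
        rw [hQa]
        refine ⟨⟨hWa', nodup_of_isWalk hWa'⟩, ?_⟩
        rw [← hla]
        simp [walkLength, hlen]
      · rw [hQo i hia hib]
        exact hP i
  refine ⟨Q, hQP, fun v => ?_, fun v hv hvr => ?_, fun v hv h1 h2 => ?_⟩
  · rw [congestion_eq_sum_count (fun i => (hQP i).1.2),
      congestion_eq_sum_count (fun i => (hP i).1.2)]
    have hmem : b ∈ Finset.univ.erase a := by simp [hab.symm]
    rw [← Finset.add_sum_erase _ _ (Finset.mem_univ a), ← Finset.add_sum_erase _ _ hmem,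
      ← Finset.add_sum_erase _ (fun i => (P i).count v) (Finset.mem_univ a),
      ← Finset.add_sum_erase _ (fun i => (P i).count v) hmem]
    have hrest : ∑ i ∈ (Finset.univ.erase a).erase b, (Q i).count v =
        ∑ i ∈ (Finset.univ.erase a).erase b, (P i).count v :=
      Finset.sum_congr rfl fun i hi => by
        rw [hQo i (Finset.ne_of_mem_erase (Finset.mem_of_mem_erase hi))
          (Finset.ne_of_mem_erase hi)]
    simp only [hrest, hQa, hQb, ha, hb, List.count_append, List.count_cons]
    omega
  · rw [ha] at hv
    rw [hQa]
    have hB : v ∈ B → r u < r v ∧ r v < r w := fun hvB => by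
      have h := List.pairwise_cons.1 (List.pairwise_append.1 hsa).2.1
      exact ⟨h.1 v (by simp [hvB]), (List.pairwise_append.1 h.2).2.2 v hvB w (by simp)⟩
    simp only [List.mem_append, List.mem_cons] at hv ⊢
    rcases hv with h | h | h | h | h
    · simp [h]
    · simp [h]
    · have := hB h
      omega
    · simp [h]
    · simp [h]
  · rw [hb] at hv
    rw [hQa]
    have hs := List.pairwise_append.1 hsb
    have hs' := List.pairwise_append.1 (List.pairwise_cons.1 hs.2.1).2
    simp only [List.mem_append, List.mem_cons] at hv ⊢
    rcases hv with h | h | h | h | h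
    · have := hs.2.2 v h u (by simp)
      omega
    · simp [h]
    · simp [h]
    · simp [h]
    · have := (List.pairwise_cons.1 hs'.2.1).1 v h
      omega

/-- If every vertex of congestion `c` is missed by fewer than a third of the walks, then any three
such vertices lie on a common walk. -/
lemma exists_mem_of_congestion_eq {k c : ℕ} (hk : k > 3 * (k - c))
    {P : Fin k → List V} {x y z : V} (hx : congestion P x = c) (hy : congestion P y = c)
    (hz : congestion P z = c) : ∃ i, x ∈ P i ∧ y ∈ P i ∧ z ∈ P i := by
  classical
  have hmiss : ∀ v, congestion P v = c →
      (Finset.univ.filter fun i => v ∉ P i).card = k - c := fun v hv => by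
    have h := Finset.card_filter_add_card_filter_not (s := (Finset.univ : Finset (Fin k)))
      (fun i => v ∈ P i)
    rw [congestion, Nat.card_eq_fintype_card, Fintype.card_subtype] at hv
    rw [Finset.card_univ, Fintype.card_fin] at h
    omega
  by_contra! hno
  have hcover : (Finset.univ : Finset (Fin k)) ⊆ (Finset.univ.filter fun i => x ∉ P i) ∪
      (Finset.univ.filter fun i => y ∉ P i) ∪ (Finset.univ.filter fun i => z ∉ P i) := by
    intro i _
    have := hno i
    simp only [Finset.mem_union, Finset.mem_filter, Finset.mem_univ, true_and]
    tauto
  have h1 := Finset.card_le_card hcover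
  have h2 := Finset.card_union_le ((Finset.univ.filter fun i => x ∉ P i) ∪
      (Finset.univ.filter fun i => y ∉ P i)) (Finset.univ.filter fun i => z ∉ P i)
  have h3 := Finset.card_union_le (Finset.univ.filter fun i => x ∉ P i)
      (Finset.univ.filter fun i => y ∉ P i)
  rw [Finset.card_univ, Fintype.card_fin] at h1
  have := hmiss x hx
  have := hmiss y hy
  have := hmiss z hz
  omega

end Rerouting

/-- The claim inside Lemma 1 of the paper: if a solution has a vertex of congestion
exactly `c`, it can be rerouted (preserving shortest paths and all congestions) so that
a single path contains all vertices of congestion `c`. -/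
theorem exists_path_through_all_max_congestion_vertices {V : Type*} [Fintype V]
    (E : V → V → Prop) (hacyc : IsAcyclic E)
    (k c d : ℕ) (hck : c ≤ k) (hd : d = k - c) (hk : k > 3 * d)
    (s t : Fin k → V) (P : Fin k → List V)
    (hP : ∀ i, IsShortestPath E (s i) (t i) (P i))
    (hcong : ∀ v, congestion P v ≤ c)
    (hfull : ∃ v, congestion P v = c) :
    ∃ P' : Fin k → List V,
      (∀ i, IsShortestPath E (s i) (t i) (P' i)) ∧
      (∀ v, congestion P' v = congestion P v) ∧
      ∃ a : Fin k, ∀ v, congestion P v = c → v ∈ P' a := by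
  subst hd
  obtain ⟨r, hr⟩ := hacyc.exists_rank
  have hinj : ∀ x y, congestion P x = c → congestion P y = c → r x = r y → x = y := by
    intro x y hx hy hxy
    obtain ⟨i, hxi, hyi, -⟩ := exists_mem_of_congestion_eq hk hx hy hy
    have hnodup : ((P i).map r).Nodup :=
      List.pairwise_map.2 (((hP i).1.1.pairwise_rank hr).imp fun h => h.ne)
    exact List.inj_on_of_nodup_map hnodup hxi hyi hxy
  obtain ⟨T, hT, hTmax⟩ := Set.exists_max_image {v | congestion P v = c} r (Set.toFinite _) hfull
  simp only [Set.mem_ofPred_eq] at hT hTmax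
  have key : ∀ n : ℕ, ∃ P' : Fin k → List V, (∀ i, IsShortestPath E (s i) (t i) (P' i)) ∧
      (∀ v, congestion P' v = congestion P v) ∧
      ∃ a, T ∈ P' a ∧ ∀ v, congestion P v = c → r v < n → v ∈ P' a := by
    intro n
    induction n with
    | zero =>
      obtain ⟨i, hi, -⟩ := exists_mem_of_congestion_eq hk hT hT hT
      exact ⟨P, hP, fun _ => rfl, i, hi, by simp⟩
    | succ n ih =>
      obtain ⟨P', hP', hc', a, hTa, hall⟩ := ih
      by_cases hex : ∃ x, congestion P x = c ∧ r x = n ∧ x ∉ P' a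
      · obtain ⟨x, hx, hxn, hxa⟩ := hex
        have hcase : ∀ v, congestion P v = c → r v < n + 1 → r v < n ∨ v = x := by
          intro v hv hvn
          rcases Nat.lt_succ_iff_lt_or_eq.1 hvn with h | h
          · exact Or.inl h
          · exact Or.inr (hinj v x hv hx (h.trans hxn.symm))
        rcases Set.eq_empty_or_nonempty {v | congestion P v = c ∧ r v < n} with hemp | hne
        · obtain ⟨i, hxi, hTi, -⟩ := exists_mem_of_congestion_eq hk
            ((hc' x).trans hx) ((hc' T).trans hT) ((hc' T).trans hT)
          refine ⟨P', hP', hc', i, hTi, fun v hv hvn => ?_⟩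
          rcases hcase v hv hvn with h | rfl
          · exact absurd (show v ∈ {v | congestion P v = c ∧ r v < n} from ⟨hv, h⟩)
              (by simp [hemp])
          · exact hxi
        · obtain ⟨u, ⟨hu, hun⟩, humax⟩ := Set.exists_max_image _ r (Set.toFinite _) hne
          obtain ⟨b, hub, hxb, hTb⟩ := exists_mem_of_congestion_eq hk
            ((hc' u).trans hu) ((hc' x).trans hx) ((hc' T).trans hT)
          have hab : a ≠ b := by rintro rfl; exact hxa hxb
          have hxT := hTmax x hx
          obtain ⟨Q, hQ, hQc, hQa, hQb⟩ := exists_swap_segment hr hP' hab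
            (by omega : r u < r T) (hall u hu hun) hTa hub hTb
          refine ⟨Q, hQ, fun v => (hQc v).trans (hc' v), a, hQa T hTa (Or.inr le_rfl),
            fun v hv hvn => ?_⟩
          rcases hcase v hv hvn with h | rfl
          · exact hQa v (hall v hv h) (Or.inl (humax v ⟨hv, h⟩))
          · exact hQb v hxb (by omega) hxT
      · push Not at hex
        refine ⟨P', hP', hc', a, hTa, fun v hv hvn => ?_⟩
        rcases Nat.lt_succ_iff_lt_or_eq.1 hvn with h | h
        · exact hall v hv h
        · exact hex v hv h
  obtain ⟨P', hP', hc', a, -, hall⟩ := key (r T + 1)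
  exact ⟨P', hP', hc', a, fun v hv => hall v hv (Nat.lt_succ_of_le (hTmax v hv))⟩
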